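/- The proof system ⊢₀ together with the (Cases) rule is sound for L2: if Γ ⊢ φ, then Γ ⊨ φ. -/

import Mathlib

inductive Tm (P R : Type) : Type
  | noun : P → Tm P R
  | allT : R → Tm P R → Tm P R

inductive Sent (P R : Type) : Type
  | allS : Tm P R → Tm P R → Sent P R
  | someS : Tm P R → Tm P R → Sent P R

structure Model (P R : Type) where
  W : Type
  nounI : P → Set W
  verbI : R → W → W → Prop

def Tm.interp {P R : Type} (M : Model P R) : Tm P R → Set M.W
  | .noun p => M.nounI p
  | .allT r x => {m | ∀ n ∈ Tm.interp M x, M.verbI r m n}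

def Model.sat {P R : Type} (M : Model P R) : Sent P R → Prop
  | .allS x y => Tm.interp M x ⊆ Tm.interp M y
  | .someS x y => (Tm.interp M x ∩ Tm.interp M y).Nonempty

def entails {P R : Type} (Γ : Set (Sent P R)) (φ : Sent P R) : Prop :=
  ∀ M : Model P R, (∀ ψ ∈ Γ, M.sat ψ) → M.sat φ

inductive Proves0 {P R : Type} (Γ : Set (Sent P R)) : Sent P R → Prop
  | hyp {φ} : φ ∈ Γ → Proves0 Γ φ
  | ax (x : Tm P R) : Proves0 Γ (Sent.allS x x)
  | barbara {x y z} : Proves0 Γ (Sent.allS x y) → Proves0 Γ (Sent.allS y z) →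
      Proves0 Γ (Sent.allS x z)
  | anti {x y} (r : R) : Proves0 Γ (Sent.allS x y) →
      Proves0 Γ (Sent.allS (Tm.allT r y) (Tm.allT r x))
  | some1 {x y} : Proves0 Γ (Sent.someS x y) → Proves0 Γ (Sent.someS x x)
  | some2 {x y} : Proves0 Γ (Sent.someS x y) → Proves0 Γ (Sent.someS y x)
  | darii {x y z} : Proves0 Γ (Sent.someS x y) → Proves0 Γ (Sent.allS y z) →
      Proves0 Γ (Sent.someS x z)

/-- The proof relation ⊢ : the rules of ⊢₀ together with the (Cases) rule, which
allows withdrawing the assumptions (some x x) and (all y (r all x)) respectively. -/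
inductive ProvesC {P R : Type} : Set (Sent P R) → Sent P R → Prop
  | hyp {Γ : Set (Sent P R)} {φ} : φ ∈ Γ → ProvesC Γ φ
  | ax {Γ : Set (Sent P R)} (x : Tm P R) : ProvesC Γ (Sent.allS x x)
  | barbara {Γ : Set (Sent P R)} {x y z} :
      ProvesC Γ (Sent.allS x y) → ProvesC Γ (Sent.allS y z) → ProvesC Γ (Sent.allS x z)
  | anti {Γ : Set (Sent P R)} {x y} (r : R) :
      ProvesC Γ (Sent.allS x y) → ProvesC Γ (Sent.allS (Tm.allT r y) (Tm.allT r x))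
  | some1 {Γ : Set (Sent P R)} {x y} :
      ProvesC Γ (Sent.someS x y) → ProvesC Γ (Sent.someS x x)
  | some2 {Γ : Set (Sent P R)} {x y} :
      ProvesC Γ (Sent.someS x y) → ProvesC Γ (Sent.someS y x)
  | darii {Γ : Set (Sent P R)} {x y z} :
      ProvesC Γ (Sent.someS x y) → ProvesC Γ (Sent.allS y z) → ProvesC Γ (Sent.someS x z)
  | cases {Γ : Set (Sent P R)} {φ} (x y : Tm P R) (r : R) :
      ProvesC (insert (Sent.someS x x) Γ) φ →
      ProvesC (insert (Sent.allS y (Tm.allT r x)) Γ) φ →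
      ProvesC Γ φ

/-- Soundness of ⊢₀ together with (Cases): if Γ ⊢ φ then Γ ⊨ φ. -/
theorem stmt10 {P R : Type} (Γ : Set (Sent P R)) (φ : Sent P R)
    (h : ProvesC Γ φ) : entails Γ φ := by
  induction h with
  | hyp hm => exact fun M hM => hM _ hm
  | ax x => exact fun M _ => Set.Subset.refl (Tm.interp M x)
  | barbara _ _ h1 h2 => exact fun M hM => Set.Subset.trans (h1 M hM) (h2 M hM)
  | anti r _ h1 => exact fun M hM m hm n hn => hm n (h1 M hM hn)
  | some1 _ h1 =>
    intro M hM
    obtain ⟨a, ha, _⟩ := h1 M hM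
    exact ⟨a, ha, ha⟩
  | some2 _ h1 =>
    intro M hM
    obtain ⟨a, ha, hb⟩ := h1 M hM
    exact ⟨a, hb, ha⟩
  | darii _ _ h1 h2 =>
    intro M hM
    obtain ⟨a, ha, hb⟩ := h1 M hM
    exact ⟨a, ha, h2 M hM hb⟩
  | cases x y r _ _ h1 h2 =>
    intro M hM
    by_cases hx : (Tm.interp M x).Nonempty
    · obtain ⟨a, ha⟩ := hx
      apply h1 M
      rintro ψ (rfl | hψ)
      · exact ⟨a, ha, ha⟩
      · exact hM ψ hψ
    · apply h2 M
      rintro ψ (rfl | hψ)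
      · exact fun m _ n hn => (hx ⟨n, hn⟩).elim
      · exact hM ψ hψ
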